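/- Let d ∈ {1,2,3}. There exists a constant C > 0 depending only on d such that for every integer n ≥ 1 (with h = 1/(n+1)) and every function u : ℝ^d → ℝ that is twice continuously differentiable on a neighbourhood of [0,1]^d and vanishes on the boundary ∂([0,1]^d), the composite trapezoid (grid) sum satisfies | ∫_{[0,1]^d} u(x) dx − h^d ∑_{i∈{1,…,n}^d} u(i·h) | ≤ C h² ‖u‖_{H²}. -/

import Mathlib

open MeasureTheory ProbabilityTheory Filter

noncomputable section

/-- The closed unit cube `[0,1]^d`. -/
def cube (d : ℕ) : Set (Fin d → ℝ) := Set.Icc 0 1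

/-- Mesh size `h = 1/(n+1)`. -/
def mesh (n : ℕ) : ℝ := 1 / (n + 1)

/-- The interior grid point `x_i = i·h` associated with `i ∈ {1,…,n}^d`
(encoded by `i : Fin d → Fin n`, the multi-index being `i + 1`). -/
def gridPt (d n : ℕ) (i : Fin d → Fin n) : Fin d → ℝ :=
  fun j => ((i j : ℕ) + 1) * mesh n

/-- The `L²`-normalised Dirichlet eigenfunction
`φ_k(x) = 2^{d/2} ∏_j sin(k_j π x_j)` of `-Δ` on `(0,1)^d`, for the multi-index
`k + 1` with `k : Fin d → ℕ`. -/
def eigenFun (d : ℕ) (k : Fin d → ℕ) (x : Fin d → ℝ) : ℝ :=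
  (2 : ℝ) ^ ((d : ℝ) / 2) * ∏ j, Real.sin (((k j : ℝ) + 1) * Real.pi * x j)

/-- The Dirichlet eigenvalue `λ_k = π² ∑_j k_j²` for the multi-index `k + 1`. -/
def lamC (d : ℕ) (k : Fin d → ℕ) : ℝ :=
  Real.pi ^ 2 * ∑ j, ((k j : ℝ) + 1) ^ 2

/-- The eigenvalue `λ_k^{(h)} = (4/h²) ∑_j sin²(k_j π h / 2)` of the discretised
Dirichlet Laplacian, for `k ∈ {1,…,n}^d` encoded by `k : Fin d → Fin n`. -/
def lamD (d n : ℕ) (k : Fin d → Fin n) : ℝ :=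
  4 / mesh n ^ 2 * ∑ j, Real.sin ((((k j : ℕ) : ℝ) + 1) * Real.pi * mesh n / 2) ^ 2

/-- The discrete inner product `⟨u,v⟩_h = h^d ∑_{i∈{1,…,n}^d} u(x_i) v(x_i)`. -/
def dInner (d n : ℕ) (u v : (Fin d → ℝ) → ℝ) : ℝ :=
  mesh n ^ d * ∑ i : Fin d → Fin n, u (gridPt d n i) * v (gridPt d n i)

/-- The partial derivative `∂_j f`. -/
def pd (d : ℕ) (j : Fin d) (f : (Fin d → ℝ) → ℝ) : (Fin d → ℝ) → ℝ :=
  fun x => fderiv ℝ f x (Pi.single j 1)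

/-- The squared Sobolev norm
`‖f‖_{H²}² = ∑_{|α| ≤ 2} ∫_{(0,1)^d} |D^α f|²`, the order-two multi-indices being the
unordered pairs `j ≤ j'`. -/
def H2sq (d : ℕ) (f : (Fin d → ℝ) → ℝ) : ℝ :=
  (∫ x in cube d, f x ^ 2) + (∑ j : Fin d, ∫ x in cube d, pd d j f x ^ 2) +
    ∑ j : Fin d, ∑ j' : Fin d,
      if j ≤ j' then ∫ x in cube d, pd d j (pd d j' f) x ^ 2 else 0

/-- The squared `Φ`-stochastically weak norm
`‖f‖_Φ² = τ² ∑_{k∈(ℤ_{≥1})^d} (1+λ_k)⁻¹ (∫ f φ_k)²`. -/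
def PhiSq (d : ℕ) (τ : ℝ) (f : (Fin d → ℝ) → ℝ) : ℝ :=
  τ ^ 2 * ∑' k : Fin d → ℕ,
    (1 + lamC d k)⁻¹ * (∫ x in cube d, f x * eigenFun d k x) ^ 2

/-- `f` is twice continuously differentiable on a neighbourhood of `[0,1]^d`. -/
def C2Nbhd (d : ℕ) (f : (Fin d → ℝ) → ℝ) : Prop :=
  ∃ U : Set (Fin d → ℝ), IsOpen U ∧ cube d ⊆ U ∧ ContDiffOn ℝ 2 f U

end

open scoped ContDiff Manifold Topology in
theorem C2Nbhd.exists_contDiff {d : ℕ} {u : (Fin d → ℝ) → ℝ} (hu : C2Nbhd d u) :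
    ∃ v : (Fin d → ℝ) → ℝ, ContDiff ℝ 2 v ∧ ∃ V : Set (Fin d → ℝ),
      IsOpen V ∧ cube d ⊆ V ∧ Set.EqOn u v V := by
  obtain ⟨U, hU, hcU, hu⟩ := hu
  obtain ⟨χ, h0, h1, -⟩ := exists_contMDiffMap_zero_one_nhds_of_isClosed
    (n := 2) 𝓘(ℝ, Fin d → ℝ) hU.isClosed_compl (t := cube d) isClosed_Icc
    (Set.disjoint_left.2 fun x hx hx' => hx (hcU hx'))
  refine ⟨fun x => χ x * u x, contDiff_iff_contDiffAt.2 fun x => ?_, ?_⟩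
  · by_cases hx : x ∈ U
    · exact χ.contMDiff.contDiff.contDiffAt.mul (hu.contDiffAt (hU.mem_nhds hx))
    · have : (fun x => χ x * u x) =ᶠ[𝓝 x] fun _ => 0 := by
        filter_upwards [eventually_nhdsSet_iff_forall.1 h0 x hx] with y hy
        simp [hy]
      exact contDiffAt_const.congr_of_eventuallyEq this
  · obtain ⟨V, hV, hcV, hVχ⟩ := mem_nhdsSet_iff_exists.1 h1
    exact ⟨V, hV, hcV, fun x hx => by simp [show χ x = 1 from hVχ hx]⟩

theorem pd_eqOn {d : ℕ} {u v : (Fin d → ℝ) → ℝ} {V : Set (Fin d → ℝ)} (hV : IsOpen V)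
    (h : Set.EqOn u v V) (j : Fin d) : Set.EqOn (pd d j u) (pd d j v) V := fun x hx => by
  simp only [pd, (h.eventuallyEq_of_mem (hV.mem_nhds hx)).fderiv_eq]

theorem H2sq_congr {d : ℕ} {u v : (Fin d → ℝ) → ℝ} {V : Set (Fin d → ℝ)} (hV : IsOpen V)
    (hc : cube d ⊆ V) (h : Set.EqOn u v V) : H2sq d u = H2sq d v := by
  have key : ∀ f g : (Fin d → ℝ) → ℝ, Set.EqOn f g V →
      ∫ x in cube d, f x ^ 2 = ∫ x in cube d, g x ^ 2 := fun f g hfg =>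
    setIntegral_congr_fun measurableSet_Icc fun x hx => by simp only [hfg (hc hx)]
  simp only [H2sq, key u v h, key _ _ (pd_eqOn hV h _),
    key _ _ (pd_eqOn hV (pd_eqOn hV h _) _)]

theorem contDiff_pd {d : ℕ} {f : (Fin d → ℝ) → ℝ} {n m : ℕ} (hf : ContDiff ℝ n f)
    (h : m + 1 ≤ n) (j : Fin d) : ContDiff ℝ m (pd d j f) :=
  (hf.fderiv_right (by exact_mod_cast h)).clm_apply contDiff_const

theorem fderiv_apply_eq_sum_pd {d : ℕ} (f : (Fin d → ℝ) → ℝ) (x y : Fin d → ℝ) :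
    fderiv ℝ f x y = ∑ j, y j * pd d j f x := by
  conv_lhs => rw [pi_eq_sum_univ' y]
  simp only [map_sum, map_smul, smul_eq_mul]
  rfl

theorem hasDerivAt_comp_smul {d : ℕ} {f : (Fin d → ℝ) → ℝ} (hf : ContDiff ℝ 1 f)
    (x : Fin d → ℝ) (t : ℝ) :
    HasDerivAt (fun s : ℝ => f (s • x)) (∑ j, x j * pd d j f (t • x)) t := by
  rw [← fderiv_apply_eq_sum_pd]
  have h1 : HasDerivAt (fun s : ℝ => s • x) x t := by
    simpa using (hasDerivAt_id t).smul_const x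
  exact ((hf.differentiable (by simp)) (t • x)).hasFDerivAt.comp_hasDerivAt t h1

theorem pd_comm {d : ℕ} {f : (Fin d → ℝ) → ℝ} (hf : ContDiff ℝ 2 f) (j k : Fin d)
    (x : Fin d → ℝ) : pd d j (pd d k f) x = pd d k (pd d j f) x := by
  have hd : DifferentiableAt ℝ (fderiv ℝ f) x :=
    (hf.fderiv_right (m := 1) (by norm_num)).differentiable (by simp) x
  have key : ∀ a b : Fin d, pd d a (pd d b f) x =
      fderiv ℝ (fderiv ℝ f) x (Pi.single a 1) (Pi.single b 1) := fun a b => by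
    change fderiv ℝ (fun y => fderiv ℝ f y (Pi.single b 1)) x (Pi.single a 1) = _
    rw [fderiv_clm_apply hd (differentiableAt_const _)]
    simp
  rw [key, key]
  exact (hf.contDiffAt.isSymmSndFDerivAt (by simp)) _ _

/-- The full sum `∑_{j,k} ∫ |∂_j ∂_k f|²` of squared second derivatives. -/
noncomputable def hessSq (d : ℕ) (f : (Fin d → ℝ) → ℝ) : ℝ :=
  ∑ j : Fin d, ∑ k : Fin d, ∫ x in cube d, pd d j (pd d k f) x ^ 2

theorem hessSq_le_two_mul_H2sq {d : ℕ} {f : (Fin d → ℝ) → ℝ} (hf : ContDiff ℝ 2 f) :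
    hessSq d f ≤ 2 * H2sq d f := by
  set I : Fin d → Fin d → ℝ := fun j k => ∫ x in cube d, pd d j (pd d k f) x ^ 2 with hI
  have hI0 : ∀ j k, 0 ≤ I j k := fun j k => integral_nonneg fun x => sq_nonneg _
  have hIc : ∀ j k, I j k = I k j := fun j k => by simp only [hI, pd_comm hf j k]
  set J : Fin d → Fin d → ℝ := fun j k => if j ≤ k then I j k else 0 with hJ
  have h1 : hessSq d f ≤ ∑ j, ∑ k, (J j k + J k j) := by
    refine Finset.sum_le_sum fun j _ => Finset.sum_le_sum fun k _ => ?_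
    change I j k ≤ _
    rcases le_total j k with h | h
    · have : 0 ≤ J k j := by simp only [hJ]; split_ifs <;> simp [hI0]
      simp only [hJ, if_pos h] at this ⊢
      linarith
    · have : 0 ≤ J j k := by simp only [hJ]; split_ifs <;> simp [hI0]
      simp only [hJ, if_pos h] at this ⊢
      linarith [hIc j k]
  have h2 : ∑ j, ∑ k, (J j k + J k j) = 2 * ∑ j, ∑ k, J j k := by
    simp only [Finset.sum_add_distrib]
    rw [Finset.sum_comm (f := fun j k => J k j)]
    ring
  have h3 : (∑ j, ∑ k, J j k) ≤ H2sq d f := by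
    refine le_add_of_nonneg_left (add_nonneg ?_ (Finset.sum_nonneg fun j _ => ?_)) <;>
    exact integral_nonneg fun x => sq_nonneg _
  linarith

theorem Continuous.integrableOn_cube {d : ℕ} {E : Type*} [NormedAddCommGroup E]
    {g : (Fin d → ℝ) → E} (hg : Continuous g) : IntegrableOn g (cube d) :=
  hg.continuousOn.integrableOn_compact isCompact_Icc

theorem volume_real_cube (d : ℕ) : volume.real (cube d) = 1 := by
  simp [cube, Measure.real, Real.volume_Icc_pi]

theorem setIntegral_abs_cube_le_sqrt {d : ℕ} {g : (Fin d → ℝ) → ℝ} (hg : Continuous g) :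
    ∫ x in cube d, |g x| ≤ √(∫ x in cube d, g x ^ 2) := by
  refine Real.le_sqrt_of_sq_le ?_
  set m := ∫ x in cube d, |g x| with hm
  have h0 : 0 ≤ ∫ x in cube d, (|g x| - m) ^ 2 := integral_nonneg fun x => sq_nonneg _
  have h1 : ∫ x in cube d, (|g x| - m) ^ 2 =
      (∫ x in cube d, g x ^ 2) - 2 * m * m + m ^ 2 := by
    have : ∀ x, (|g x| - m) ^ 2 = g x ^ 2 - 2 * m * |g x| + m ^ 2 := fun x => by
      rw [sub_sq, sq_abs]; ring
    simp only [this]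
    rw [integral_add, integral_sub, integral_const_mul, ← hm]
    · simp [volume_real_cube]
    · exact (hg.pow 2).integrableOn_cube
    · exact (continuous_const.mul hg.abs).integrableOn_cube
    · exact ((hg.pow 2).sub (continuous_const.mul hg.abs)).integrableOn_cube
    · exact continuous_const.integrableOn_cube
  nlinarith

theorem setIntegral_cube_comp_smul_le {d : ℕ} {g : (Fin d → ℝ) → ℝ} (hg : Continuous g)
    (h0 : ∀ x, 0 ≤ g x) {t : ℝ} (ht : 0 < t) (ht1 : t ≤ 1) :
    ∫ x in cube d, g (t • x) ≤ (t ^ d)⁻¹ * ∫ x in cube d, g x := by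
  rw [Measure.setIntegral_comp_smul_of_pos _ _ _ ht, Module.finrank_fin_fun, smul_eq_mul]
  refine mul_le_mul_of_nonneg_left (setIntegral_mono_set hg.integrableOn_cube
    (Eventually.of_forall h0) (LE.le.eventuallyLE ?_)) (by positivity)
  rintro _ ⟨x, hx, rfl⟩
  refine ⟨fun j => ?_, fun j => ?_⟩
  · have := hx.1 j
    simp only [Pi.zero_apply, Pi.smul_apply, smul_eq_mul] at this ⊢
    positivity
  · have h1 := hx.1 j
    have h2 := hx.2 j
    simp only [Pi.zero_apply, Pi.one_apply, Pi.smul_apply, smul_eq_mul] at h1 h2 ⊢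
    nlinarith

theorem integral_pd_eq_zero {d : ℕ} {g : (Fin d → ℝ) → ℝ} (hg : ContDiff ℝ 1 g) (j : Fin d)
    (h : ∀ x ∈ cube d, x j = 0 ∨ x j = 1 → g x = 0) : ∫ x in cube d, pd d j g x = 0 := by
  obtain ⟨m, rfl⟩ : ∃ m, d = m + 1 := ⟨d - 1, by have := j.pos; omega⟩
  have hdiff := hg.differentiable (by simp)
  have key := integral_divergence_of_hasFDerivAt_off_countable' (E := ℝ)
    (0 : Fin (m + 1) → ℝ) 1 (fun i => zero_le_one)
    (fun i x => if i = j then g x else 0) (fun i x => if i = j then fderiv ℝ g x else 0)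
    ∅ Set.countable_empty
    (fun i => by
      by_cases hi : i = j
      · simpa only [hi, if_true] using hg.continuous.continuousOn
      · simpa only [hi, if_false] using continuousOn_const)
    (fun x _ i => by
      by_cases hi : i = j
      · simpa only [hi, if_true] using (hdiff x).hasFDerivAt
      · simpa only [hi, if_false] using hasFDerivAt_const _ _)
  have hsum : ∀ x, ∑ i, (if i = j then fderiv ℝ g x else 0) (Pi.single i 1) =
      pd (m + 1) j g x := fun x => by
    rw [Finset.sum_eq_single j (fun i _ hi => by simp [hi]) (by simp)]
    simp [pd]
  simp only [hsum] at key
  rw [cube, key (contDiff_pd (n := 1) (m := 0) hg le_rfl j).continuous.integrableOn_cube]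
  refine Finset.sum_eq_zero fun i _ => ?_
  by_cases hi : i = j
  · subst hi
    have hface : ∀ c : ℝ, c = 0 ∨ c = 1 → ∀ y ∈ Set.Icc ((0 : Fin (m + 1) → ℝ) ∘ i.succAbove)
        ((1 : Fin (m + 1) → ℝ) ∘ i.succAbove), g (i.insertNth c y) = 0 := fun c hc y hy => by
      refine h _ ?_ (by simpa using hc)
      have hc' : 0 ≤ c ∧ c ≤ 1 := by rcases hc with rfl | rfl <;> simp
      constructor <;> intro k <;> refine Fin.succAboveCases i ?_ (fun l => ?_) k
      · simpa using hc'.1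
      · simpa using hy.1 l
      · simpa using hc'.2
      · simpa using hy.2 l
    simp only [if_true]
    rw [setIntegral_eq_zero_of_forall_eq_zero (fun y hy => hface _ (by simp) y hy),
      setIntegral_eq_zero_of_forall_eq_zero (fun y hy => hface _ (by simp) y hy), sub_zero]
  · simp [hi]

theorem abs_integral_sub_half_mul_le {d : ℕ} {p : (Fin d → ℝ) → ℝ} (hp : ContDiff ℝ 1 p)
    (j : Fin d) :
    |∫ x in cube d, (x j - 1 / 2) * p x| ≤ ∫ x in cube d, |pd d j p x| := by
  have hq : ContDiff ℝ 1 (fun x : Fin d → ℝ => (x j ^ 2 - x j) / 2) := by fun_prop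
  have h0 := integral_pd_eq_zero (hq.mul hp) j fun x _ hx => by
    rcases hx with hx | hx <;> simp [hx]
  have hpc : Continuous (pd d j p) := (contDiff_pd (n := 1) (m := 0) hp le_rfl j).continuous
  have hpd : ∀ x : Fin d → ℝ, pd d j (fun x => (x j ^ 2 - x j) / 2 * p x) x =
      (x j - 1 / 2) * p x + (x j ^ 2 - x j) / 2 * pd d j p x := fun x => by
    have e1 : HasFDerivAt (fun x : Fin d → ℝ => x j)
      (ContinuousLinearMap.proj (R := ℝ) (φ := fun _ : Fin d => ℝ) j) x := hasFDerivAt_apply j x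
    have e2 := (((e1.pow 2).sub e1).mul_const (1 / 2 : ℝ)).mul
      ((hp.differentiable (by simp)) x).hasFDerivAt
    have e3 : (fun x : Fin d → ℝ => (x j ^ 2 - x j) / 2 * p x) =
      fun x => (x j ^ 2 - x j) * (1 / 2) * p x := by funext; ring
    simp only [pd, e3]
    erw [e2.fderiv]
    simp
    ring
  simp only [hpd] at h0
  rw [integral_add, add_eq_zero_iff_eq_neg] at h0
  · rw [h0, abs_neg]
    refine (abs_integral_le_integral_abs).trans (setIntegral_mono_on ?_ ?_ measurableSet_Icc ?_)
    · exact (hq.continuous.mul hpc).abs.integrableOn_cube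
    · exact hpc.abs.integrableOn_cube
    · intro x hx
      have h1 := hx.1 j
      have h2 := hx.2 j
      simp only [Pi.zero_apply, Pi.one_apply] at h1 h2
      rw [abs_mul]
      refine mul_le_of_le_one_left (abs_nonneg _) (abs_le.2 ⟨?_, ?_⟩) <;> nlinarith
  · exact (((continuous_apply j).sub continuous_const).mul hp.continuous).integrableOn_cube
  · exact (hq.continuous.mul hpc).integrableOn_cube

theorem setIntegral_pd_pd_sq_le_hessSq {d : ℕ} (f : (Fin d → ℝ) → ℝ) (j k : Fin d) :
    ∫ x in cube d, pd d j (pd d k f) x ^ 2 ≤ hessSq d f := by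
  have h0 : ∀ j k, 0 ≤ ∫ x in cube d, pd d j (pd d k f) x ^ 2 := fun j k =>
    integral_nonneg fun x => sq_nonneg _
  exact (Finset.single_le_sum (f := fun k => ∫ x in cube d, pd d j (pd d k f) x ^ 2)
    (fun k _ => h0 j k) (Finset.mem_univ k)).trans
    (Finset.single_le_sum (f := fun j => ∑ k, ∫ x in cube d, pd d j (pd d k f) x ^ 2)
    (fun j _ => Finset.sum_nonneg fun k _ => h0 j k) (Finset.mem_univ j))

/-- The second derivative of `f` at `y` applied to the pair `(x, x)`. -/
noncomputable def hessForm (d : ℕ) (f : (Fin d → ℝ) → ℝ) (x y : Fin d → ℝ) : ℝ :=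
  ∑ k, x k * ∑ j, x j * pd d j (pd d k f) y

theorem continuous_pd_pd {d : ℕ} {f : (Fin d → ℝ) → ℝ} (hf : ContDiff ℝ 2 f) (j k : Fin d) :
    Continuous (pd d j (pd d k f)) :=
  (contDiff_pd (n := 1) (m := 0) (contDiff_pd (n := 2) (m := 1) hf le_rfl k) le_rfl j).continuous

theorem continuous_hessForm {d : ℕ} {f : (Fin d → ℝ) → ℝ} (hf : ContDiff ℝ 2 f) :
    Continuous fun p : (Fin d → ℝ) × (Fin d → ℝ) => hessForm d f p.1 p.2 := by
  have := continuous_pd_pd hf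
  unfold hessForm
  fun_prop

theorem taylor_at_corner {d : ℕ} {f : (Fin d → ℝ) → ℝ} (hf : ContDiff ℝ 2 f) (x : Fin d → ℝ) :
    f 0 = f x - ∑ k, x k * pd d k f x + ∫ t in (0 : ℝ)..1, t * hessForm d f x (t • x) := by
  have h1 : ContDiff ℝ 1 f := hf.of_le (by norm_num)
  have hder : ∀ t ∈ Set.uIcc (0 : ℝ) 1,
      HasDerivAt (fun t : ℝ => t * (∑ k, x k * pd d k f (t • x)) - f (t • x))
        (t * hessForm d f x (t • x)) t := fun t _ => by
    have e1 : HasDerivAt (fun t : ℝ => ∑ k, x k * pd d k f (t • x))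
        (hessForm d f x (t • x)) t := by
      refine HasDerivAt.fun_sum fun k _ => ?_
      exact (hasDerivAt_comp_smul (contDiff_pd (n := 2) (m := 1) hf le_rfl k) x t).const_mul _
    refine (((hasDerivAt_id t).mul e1).sub (hasDerivAt_comp_smul h1 x t)).congr_deriv ?_
    simp
  have hc : Continuous fun t : ℝ => t * hessForm d f x (t • x) :=
    continuous_id.mul ((continuous_hessForm hf).comp
      (continuous_const.prodMk (continuous_id.smul continuous_const)))
  rw [intervalIntegral.integral_eq_sub_of_hasDerivAt hder (hc.intervalIntegrable _ _)]
  simp only [one_smul, zero_smul, one_mul, zero_mul, zero_sub, sub_neg_eq_add]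
  ring

theorem abs_integral_hessForm_smul_le {d : ℕ} (hd : d ≤ 3) {f : (Fin d → ℝ) → ℝ}
    (hf : ContDiff ℝ 2 f) {t : ℝ} (ht : 0 < t) (ht1 : t ≤ 1) :
    |∫ x in cube d, t * hessForm d f x (t • x)| ≤
      t ^ (-(1 / 2) : ℝ) * (d ^ 2 * √(hessSq d f)) := by
  have hc := continuous_pd_pd hf
  have hct : ∀ j k, Continuous fun x : Fin d → ℝ => pd d j (pd d k f) (t • x) := fun j k =>
    (hc j k).comp (continuous_const_smul t)
  have hterm : ∀ j k, t * ∫ x in cube d, |pd d j (pd d k f) (t • x)| ≤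
      t ^ (-(1 / 2) : ℝ) * √(hessSq d f) := fun j k => by
    have e1 : ∫ x in cube d, |pd d j (pd d k f) (t • x)| ≤ √((t ^ d)⁻¹ * hessSq d f) := by
      refine (setIntegral_abs_cube_le_sqrt (hct j k)).trans (Real.sqrt_le_sqrt ?_)
      refine (setIntegral_cube_comp_smul_le ((hc j k).pow 2) (fun x => sq_nonneg _) ht ht1).trans ?_
      refine mul_le_mul_of_nonneg_left ?_ (by positivity)
      exact setIntegral_pd_pd_sq_le_hessSq f j k
    have e2 : t * √((t ^ d)⁻¹) ≤ t ^ (-(1 / 2) : ℝ) := by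
      have e3 : t ^ (-(1 / 2) : ℝ) = √(t⁻¹) := by
        rw [Real.sqrt_eq_rpow, Real.inv_rpow ht.le, Real.rpow_neg ht.le]
      rw [e3]
      refine Real.le_sqrt_of_sq_le ?_
      rw [mul_pow, Real.sq_sqrt (by positivity), ← div_eq_mul_inv, div_le_iff₀ (by positivity),
        ← div_eq_inv_mul, le_div_iff₀ ht]
      calc t ^ 2 * t = t ^ 3 := by ring
        _ ≤ t ^ d := pow_le_pow_of_le_one ht.le ht1 hd
    calc t * ∫ x in cube d, |pd d j (pd d k f) (t • x)|
        ≤ t * √((t ^ d)⁻¹ * hessSq d f) := by gcongr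
      _ = t * √((t ^ d)⁻¹) * √(hessSq d f) := by
        rw [Real.sqrt_mul (by positivity)]; ring
      _ ≤ _ := by gcongr
  have hpt : ∀ x ∈ cube d, |t * hessForm d f x (t • x)| ≤
      ∑ k, ∑ j, t * |pd d j (pd d k f) (t • x)| := fun x hx => by
    have hx1 : ∀ k, |x k| ≤ 1 := fun k => by
      have h1 := hx.1 k
      have h2 := hx.2 k
      simp only [Pi.zero_apply, Pi.one_apply] at h1 h2
      rwa [abs_of_nonneg h1]
    simp only [← Finset.mul_sum]
    rw [abs_mul, abs_of_pos ht]
    refine mul_le_mul_of_nonneg_left ?_ ht.le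
    refine (Finset.abs_sum_le_sum_abs _ _).trans (Finset.sum_le_sum fun k _ => ?_)
    rw [abs_mul]
    refine (mul_le_of_le_one_left (abs_nonneg _) (hx1 k)).trans ?_
    refine (Finset.abs_sum_le_sum_abs _ _).trans (Finset.sum_le_sum fun j _ => ?_)
    rw [abs_mul]
    exact mul_le_of_le_one_left (abs_nonneg _) (hx1 j)
  have hint : ∀ k j, IntegrableOn (fun x => t * |pd d j (pd d k f) (t • x)|) (cube d) :=
    fun k j => (continuous_const.mul (hct j k).abs).integrableOn_cube
  calc |∫ x in cube d, t * hessForm d f x (t • x)|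
      ≤ ∫ x in cube d, |t * hessForm d f x (t • x)| := abs_integral_le_integral_abs
    _ ≤ ∫ x in cube d, ∑ k, ∑ j, t * |pd d j (pd d k f) (t • x)| := by
      refine setIntegral_mono_on ?_ ?_ measurableSet_Icc hpt
      · exact (continuous_const.mul ((continuous_hessForm hf).comp
          (continuous_id.prodMk (continuous_const_smul t)))).abs.integrableOn_cube
      · exact Continuous.integrableOn_cube (continuous_finsetSum _ fun k _ =>
          continuous_finsetSum _ fun j _ => continuous_const.mul (hct j k).abs)
    _ = ∑ k, ∑ j, t * ∫ x in cube d, |pd d j (pd d k f) (t • x)| := by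
      rw [integral_finsetSum _ fun k _ => integrable_finsetSum _ fun j _ => hint k j]
      refine Finset.sum_congr rfl fun k _ => ?_
      rw [integral_finsetSum _ fun j _ => hint k j]
      simp only [integral_const_mul]
    _ ≤ ∑ k : Fin d, ∑ j : Fin d, t ^ (-(1 / 2) : ℝ) * √(hessSq d f) :=
      Finset.sum_le_sum fun k _ => Finset.sum_le_sum fun j _ => hterm j k
    _ = _ := by simp; ring

theorem abs_integral_remainder_le {d : ℕ} (hd : d ≤ 3) {f : (Fin d → ℝ) → ℝ}
    (hf : ContDiff ℝ 2 f) :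
    |∫ x in cube d, ∫ t in (0 : ℝ)..1, t * hessForm d f x (t • x)| ≤
      2 * (d ^ 2 * √(hessSq d f)) := by
  have hc : Continuous (Function.uncurry fun (t : ℝ) (x : Fin d → ℝ) =>
      t * hessForm d f x (t • x)) :=
    continuous_fst.mul ((continuous_hessForm hf).comp
      (continuous_snd.prodMk (continuous_fst.smul continuous_snd)))
  rw [← intervalIntegral_integral_swap]
  · have hI : ∫ t in (0 : ℝ)..1, t ^ (-(1 / 2) : ℝ) * (d ^ 2 * √(hessSq d f)) =
        2 * (d ^ 2 * √(hessSq d f)) := by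
      rw [intervalIntegral.integral_mul_const, integral_rpow (Or.inl (by norm_num))]
      norm_num
    rw [← hI, ← Real.norm_eq_abs]
    refine intervalIntegral.norm_integral_le_of_norm_le zero_le_one
      (Eventually.of_forall fun t ht => ?_)
      ((intervalIntegral.intervalIntegrable_rpow' (by norm_num)).mul_const _)
    exact abs_integral_hessForm_smul_le hd hf ht.1 ht.2
  · rw [Measure.prod_restrict]
    exact (hc.continuousOn.integrableOn_compact
      ((isCompact_uIcc (a := (0 : ℝ)) (b := 1)).prod (isCompact_Icc : IsCompact (cube d)))).mono_set
      (Set.prod_mono Set.uIoc_subset_uIcc le_rfl)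

theorem abs_integral_sub_corner_le {d : ℕ} (hd : d ≤ 3) {f : (Fin d → ℝ) → ℝ}
    (hf : ContDiff ℝ 2 f) :
    |(∫ x in cube d, f x) - f 0 - 1 / 2 * ∑ k, ∫ x in cube d, pd d k f x| ≤
      (2 * d ^ 2 + d) * √(hessSq d f) := by
  have hp : ∀ k, ContDiff ℝ 1 (pd d k f) := fun k => contDiff_pd (n := 2) (m := 1) hf le_rfl k
  have hpc : ∀ k, Continuous (pd d k f) := fun k => (hp k).continuous
  have hxp : ∀ k, Continuous fun x : Fin d → ℝ => x k * pd d k f x := fun k =>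
    (continuous_apply k).mul (hpc k)
  have hR : Continuous fun x : Fin d → ℝ => ∫ t in (0 : ℝ)..1, t * hessForm d f x (t • x) := by
    refine intervalIntegral.continuous_parametric_intervalIntegral_of_continuous' ?_ _ _
    exact continuous_snd.mul ((continuous_hessForm hf).comp
      (continuous_fst.prodMk (continuous_snd.smul continuous_fst)))
  have hS : Continuous fun x : Fin d → ℝ => ∑ k, x k * pd d k f x :=
    continuous_finsetSum _ fun k _ => hxp k
  have h0 : f 0 = (∫ x in cube d, f x) - (∑ k, ∫ x in cube d, x k * pd d k f x) +
      ∫ x in cube d, ∫ t in (0 : ℝ)..1, t * hessForm d f x (t • x) := by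
    have e := integral_add (μ := volume.restrict (cube d))
      (hf.continuous.integrableOn_cube.sub hS.integrableOn_cube) hR.integrableOn_cube
    simp only [Pi.sub_apply, ← taylor_at_corner hf] at e
    rw [integral_sub hf.continuous.integrableOn_cube hS.integrableOn_cube,
      integral_finsetSum _ fun k _ => (hxp k).integrableOn_cube] at e
    rw [← e]
    simp [volume_real_cube]
  have h1 : ∀ k, ∫ x in cube d, (x k - 1 / 2) * pd d k f x =
      (∫ x in cube d, x k * pd d k f x) - 1 / 2 * ∫ x in cube d, pd d k f x := fun k => by
    simp only [sub_mul]
    rw [integral_sub (hxp k).integrableOn_cube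
      ((hpc k).integrableOn_cube.const_mul _), integral_const_mul]
  have h2 : (∫ x in cube d, f x) - f 0 - 1 / 2 * ∑ k, ∫ x in cube d, pd d k f x =
      (∑ k, ∫ x in cube d, (x k - 1 / 2) * pd d k f x) -
        ∫ x in cube d, ∫ t in (0 : ℝ)..1, t * hessForm d f x (t • x) := by
    simp only [h1, Finset.sum_sub_distrib, ← Finset.mul_sum]
    linarith
  have h3 : ∀ k, |∫ x in cube d, (x k - 1 / 2) * pd d k f x| ≤ √(hessSq d f) := fun k => by
    refine (abs_integral_sub_half_mul_le (hp k) k).trans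
      ((setIntegral_abs_cube_le_sqrt (continuous_pd_pd hf k k)).trans (Real.sqrt_le_sqrt ?_))
    exact setIntegral_pd_pd_sq_le_hessSq f k k
  rw [h2]
  refine (abs_sub _ _).trans ?_
  have h4 : |∑ k, ∫ x in cube d, (x k - 1 / 2) * pd d k f x| ≤ d * √(hessSq d f) := by
    refine (Finset.abs_sum_le_sum_abs _ _).trans ((Finset.sum_le_sum fun k _ => h3 k).trans ?_)
    simp
  have h5 := abs_integral_remainder_le hd hf
  linarith

/-- The lower corner of the cell of the integer grid indexed by `c`. -/
def cellCorner {d N : ℕ} (c : Fin d → Fin N) : Fin d → ℝ := fun j => (c j : ℕ)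

theorem setIntegral_Icc_eq_sum_cells {d N : ℕ} {g : (Fin d → ℝ) → ℝ} (hg : Continuous g) :
    ∫ z in Set.Icc (0 : Fin d → ℝ) (fun _ => (N : ℝ)), g z =
      ∑ c : Fin d → Fin N, ∫ y in cube d, g (y + cellCorner c) := by
  set S : (Fin d → Fin N) → Set (Fin d → ℝ) := fun c =>
    Set.univ.pi fun j => Set.Ico (cellCorner c j) (cellCorner c j + 1) with hS
  have hSicc : ∀ c, S c =ᵐ[volume] Set.Icc (cellCorner c) (cellCorner c + 1) := fun c =>
    Measure.univ_pi_Ico_ae_eq_Icc (μ := fun _ => volume)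
  have hcell : ∀ c : Fin d → Fin N, ∫ y in cube d, g (y + cellCorner c) = ∫ z in S c, g z :=
    fun c => by
      have e := (measurePreserving_add_right volume (cellCorner c)).setIntegral_preimage_emb
        (measurableEmbedding_addRight _) g (Set.Icc (cellCorner c) (cellCorner c + 1))
      rw [setIntegral_congr_set (hSicc c), ← e]
      simp [cube]
  have hunion : (Set.univ.pi fun _ : Fin d => Set.Ico (0 : ℝ) N) = ⋃ c, S c := by
    ext z
    simp only [hS, Set.mem_iUnion, Set.mem_univ_pi, Set.mem_Ico, cellCorner]
    constructor
    · intro hz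
      refine ⟨fun j => ⟨⌊z j⌋₊, (Nat.floor_lt (hz j).1).2 (hz j).2⟩, fun j => ?_⟩
      exact ⟨Nat.floor_le (hz j).1, Nat.lt_floor_add_one _⟩
    · rintro ⟨c, hc⟩ j
      refine ⟨(Nat.cast_nonneg _).trans (hc j).1, (hc j).2.trans_le ?_⟩
      exact_mod_cast (c j).2
  have hdisj : Pairwise (Function.onFun Disjoint S) := fun c c' hne => by
    refine Set.disjoint_left.2 fun z hz hz' => hne (funext fun j => Fin.ext ?_)
    simp only [hS, Set.mem_univ_pi, Set.mem_Ico, cellCorner] at hz hz'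
    have e : ∀ m : ℕ, (m : ℝ) ≤ z j ∧ z j < m + 1 → ⌊z j⌋₊ = m := fun m hm =>
      (Nat.floor_eq_iff ((Nat.cast_nonneg _).trans hm.1)).2 hm
    rw [← e _ (hz j), ← e _ (hz' j)]
  have hbox : (Set.univ.pi fun _ : Fin d => Set.Ico (0 : ℝ) N) =ᵐ[volume]
      Set.Icc (0 : Fin d → ℝ) (fun _ => (N : ℝ)) :=
    Measure.univ_pi_Ico_ae_eq_Icc (μ := fun _ => volume)
  rw [← setIntegral_congr_set hbox, hunion, integral_iUnion_fintype
    (fun c => MeasurableSet.univ_pi fun _ => measurableSet_Ico) hdisj fun c => ?_]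
  · exact Finset.sum_congr rfl fun c _ => (hcell c).symm
  · exact IntegrableOn.congr_set_ae
      (hg.continuousOn.integrableOn_compact isCompact_Icc) (hSicc c)

theorem mesh_pos (n : ℕ) : 0 < mesh n := by
  unfold mesh
  positivity

theorem setIntegral_cube_eq_sum_cells {d : ℕ} (n : ℕ) {g : (Fin d → ℝ) → ℝ}
    (hg : Continuous g) :
    ∫ x in cube d, g x = ∑ c : Fin d → Fin (n + 1),
      mesh n ^ d * ∫ y in cube d, g (mesh n • (y + cellCorner c)) := by
  have hh := mesh_pos n
  have hN : mesh n * ((n + 1 : ℕ) : ℝ) = 1 := by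
    unfold mesh
    push_cast
    field_simp
  rw [← Finset.mul_sum, ← setIntegral_Icc_eq_sum_cells (g := fun z => g (mesh n • z))
    (hg.comp (continuous_const_smul _)), Measure.setIntegral_comp_smul_of_pos _ _ _ hh,
    Module.finrank_fin_fun, smul_eq_mul, mul_inv_cancel_left₀ (by positivity)]
  congr 2
  ext x
  rw [Set.mem_smul_set_iff_inv_smul_mem₀ hh.ne']
  simp only [cube, Set.mem_Icc, Pi.le_def, Pi.zero_apply, Pi.one_apply, Pi.smul_apply, smul_eq_mul]
  refine and_congr (forall_congr' fun j => ?_) (forall_congr' fun j => ?_)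
  · rw [mul_nonneg_iff_of_pos_left (by positivity)]
  · rw [inv_mul_le_iff₀ hh, hN]

theorem sum_cellCorner_eq_sum_gridPt {d n : ℕ} {u : (Fin d → ℝ) → ℝ}
    (hu : ∀ x ∈ cube d, ∀ j, x j = 0 ∨ x j = 1 → u x = 0) :
    ∑ c : Fin d → Fin (n + 1), u (mesh n • cellCorner c) =
      ∑ i : Fin d → Fin n, u (gridPt d n i) := by
  symm
  refine Fintype.sum_of_injective (fun i j => (i j).succ) (fun i i' h => ?_) _ _
    (fun c hc => ?_) fun i => ?_
  · exact funext fun j => Fin.succ_injective _ (congrFun h j)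
  · obtain ⟨j, hj⟩ : ∃ j, c j = 0 := by
      by_contra! hne
      exact hc ⟨fun j => (c j).pred (hne j), funext fun j => Fin.succ_pred _ _⟩
    refine hu _ ⟨fun k => ?_, fun k => ?_⟩ j (Or.inl (by simp [cellCorner, hj]))
    · have := mesh_pos n
      simp only [Pi.zero_apply, Pi.smul_apply, smul_eq_mul, cellCorner]
      positivity
    · have : ((c k : ℕ) : ℝ) ≤ n + 1 := by exact_mod_cast (c k).2.le
      simp only [Pi.one_apply, Pi.smul_apply, smul_eq_mul, cellCorner, mesh]
      rw [one_div, inv_mul_le_iff₀ (by positivity)]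
      linarith
  · congr 1
    funext j
    simp [gridPt, cellCorner, mul_comm]

theorem pd_comp_smul_add {d : ℕ} {f : (Fin d → ℝ) → ℝ} (hf : Differentiable ℝ f) (a h : ℝ)
    (c : Fin d → ℝ) (j : Fin d) :
    pd d j (fun y => a * f (h • (y + c))) = fun y => a * h * pd d j f (h • (y + c)) := by
  funext y
  have e1 : HasFDerivAt (fun y : Fin d → ℝ => h • (y + c))
      (h • ContinuousLinearMap.id ℝ (Fin d → ℝ)) y :=
    ((hasFDerivAt_id y).add_const c).const_smul h
  have e2 := (((hf (h • (y + c))).hasFDerivAt.comp y e1)).const_mul a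
  change fderiv ℝ (fun y => a * f (h • (y + c))) y (Pi.single j 1) = _
  erw [e2.fderiv]
  simp [pd, mul_assoc]

theorem abs_integral_sub_grid_sum_le {d : ℕ} (hd : d ≤ 3) (n : ℕ) {u : (Fin d → ℝ) → ℝ}
    (hu : ContDiff ℝ 2 u) (h0 : ∀ x ∈ cube d, ∀ j, x j = 0 ∨ x j = 1 → u x = 0) :
    |(∫ x in cube d, u x) - mesh n ^ d * ∑ i : Fin d → Fin n, u (gridPt d n i)| ≤
      (2 * d ^ 2 + d) * mesh n ^ 2 * √(hessSq d u) := by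
  set h := mesh n with hh
  have hpos : 0 < h := mesh_pos n
  have hu1 : ContDiff ℝ 1 u := hu.of_le (by norm_num)
  have hp : ∀ k, ContDiff ℝ 1 (pd d k u) := fun k => contDiff_pd (n := 2) (m := 1) hu le_rfl k
  set f : (Fin d → Fin (n + 1)) → (Fin d → ℝ) → ℝ := fun c y => u (h • (y + cellCorner c))
    with hf_def
  have hf : ∀ c, ContDiff ℝ 2 (f c) := fun c =>
    hu.comp ((contDiff_id.add contDiff_const).const_smul h)
  have hpf : ∀ c k, pd d k (f c) = fun y => h * pd d k u (h • (y + cellCorner c)) := fun c k => by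
    simpa only [one_mul] using pd_comp_smul_add (hu1.differentiable (by simp)) 1 h (cellCorner c) k
  have hppf : ∀ c j k, pd d j (pd d k (f c)) =
      fun y => h * h * pd d j (pd d k u) (h • (y + cellCorner c)) := fun c j k => by
    rw [hpf]
    exact pd_comp_smul_add ((hp k).differentiable (by simp)) h h (cellCorner c) j
  have hf0 : ∑ c, h ^ d * f c 0 = h ^ d * ∑ i : Fin d → Fin n, u (gridPt d n i) := by
    rw [← sum_cellCorner_eq_sum_gridPt h0, Finset.mul_sum]
    simp [hf_def, hh]
  have hgrad : ∀ k, ∑ c, h ^ d * ∫ x in cube d, pd d k (f c) x = 0 := fun k => by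
    have e := setIntegral_cube_eq_sum_cells n (hp k).continuous
    rw [integral_pd_eq_zero hu1 k fun x hx => h0 x hx k] at e
    simp only [hpf, integral_const_mul, mul_left_comm _ h]
    rw [← Finset.mul_sum, ← e, mul_zero]
  have hhess : ∑ c, h ^ d * hessSq d (f c) = h ^ 4 * hessSq d u := by
    simp only [hessSq, hppf, mul_pow, integral_const_mul, Finset.mul_sum]
    rw [Finset.sum_comm]
    refine Finset.sum_congr rfl fun j _ => ?_
    rw [Finset.sum_comm]
    refine Finset.sum_congr rfl fun k _ => ?_
    rw [setIntegral_cube_eq_sum_cells n (g := fun x => pd d j (pd d k u) x ^ 2)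
      ((continuous_pd_pd hu j k).pow 2), Finset.mul_sum]
    refine Finset.sum_congr rfl fun c _ => ?_
    ring
  have hone : ∑ _c : Fin d → Fin (n + 1), h ^ d = 1 := by
    simp only [Finset.sum_const, Finset.card_univ, Fintype.card_fun, Fintype.card_fin,
      nsmul_eq_mul, hh, mesh]
    push_cast
    rw [← mul_pow, mul_one_div_cancel (by positivity), one_pow]
  have hdecomp : (∫ x in cube d, u x) - h ^ d * ∑ i : Fin d → Fin n, u (gridPt d n i) =
      ∑ c, h ^ d * ((∫ x in cube d, f c x) - f c 0 -
        1 / 2 * ∑ k, ∫ x in cube d, pd d k (f c) x) := by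
    have e : ∑ c, h ^ d * (1 / 2 * ∑ k, ∫ x in cube d, pd d k (f c) x) = 0 := by
      simp only [mul_left_comm _ (1 / 2 : ℝ), Finset.mul_sum (Finset.univ : Finset (Fin d))]
      rw [Finset.sum_comm]
      refine Finset.sum_eq_zero fun k _ => ?_
      rw [← Finset.mul_sum, hgrad, mul_zero]
    simp only [mul_sub, Finset.sum_sub_distrib]
    rw [e, hf0, setIntegral_cube_eq_sum_cells n hu.continuous, sub_zero]
  have hhess0 : ∀ c, 0 ≤ hessSq d (f c) := fun c =>
    Finset.sum_nonneg fun j _ => Finset.sum_nonneg fun k _ => integral_nonneg fun x => sq_nonneg _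
  rw [hdecomp]
  calc |∑ c, h ^ d * ((∫ x in cube d, f c x) - f c 0 -
        1 / 2 * ∑ k, ∫ x in cube d, pd d k (f c) x)|
      ≤ ∑ c, h ^ d * ((2 * d ^ 2 + d) * √(hessSq d (f c))) := by
        refine (Finset.abs_sum_le_sum_abs _ _).trans (Finset.sum_le_sum fun c _ => ?_)
        rw [abs_mul, abs_of_nonneg (by positivity : 0 ≤ h ^ d)]
        exact mul_le_mul_of_nonneg_left (abs_integral_sub_corner_le hd (hf c)) (by positivity)
    _ = (2 * d ^ 2 + d) * ∑ c, √(h ^ d) * √(h ^ d * hessSq d (f c)) := by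
        rw [Finset.mul_sum]
        refine Finset.sum_congr rfl fun c _ => ?_
        rw [Real.sqrt_mul (by positivity), ← mul_assoc √(h ^ d),
          Real.mul_self_sqrt (by positivity)]
        ring
    _ ≤ (2 * d ^ 2 + d) * (√(∑ _c : Fin d → Fin (n + 1), h ^ d) *
          √(∑ c, h ^ d * hessSq d (f c))) := by
        refine mul_le_mul_of_nonneg_left (Real.sum_sqrt_mul_sqrt_le _ (fun c => by positivity)
          fun c => mul_nonneg (by positivity) (hhess0 c)) (by positivity)
    _ = (2 * d ^ 2 + d) * h ^ 2 * √(hessSq d u) := by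
        rw [hone, hhess, Real.sqrt_one, one_mul, Real.sqrt_mul (by positivity),
          show h ^ 4 = (h ^ 2) ^ 2 by ring, Real.sqrt_sq (by positivity)]
        ring

theorem mem_frontier_cube {d : ℕ} {x : Fin d → ℝ} (hx : x ∈ cube d) {j : Fin d}
    (hj : x j = 0 ∨ x j = 1) : x ∈ frontier (cube d) := by
  refine ⟨subset_closure hx, fun hi => ?_⟩
  rw [cube, ← Set.pi_univ_Icc, interior_pi_set Set.finite_univ] at hi
  have := hi j trivial
  simp only [Pi.zero_apply, Pi.one_apply, interior_Icc, Set.mem_Ioo] at this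
  rcases hj with hj | hj <;> simp [hj] at this

/-- **Trapezoid-rule error estimate (Bramble–Hilbert).**
For `d ∈ {1,2,3}` there is a constant `C = C(d) > 0` such that for every `n ≥ 1`
(with `h = 1/(n+1)`) and every `u` twice continuously differentiable near `[0,1]^d`
vanishing on the boundary of the cube,
`|∫_{[0,1]^d} u - h^d ∑_{i∈{1,…,n}^d} u(i·h)| ≤ C h² ‖u‖_{H²}`. -/
theorem stmt_9 (d : ℕ) (hd : d = 1 ∨ d = 2 ∨ d = 3) :
    ∃ C : ℝ, 0 < C ∧
      ∀ (n : ℕ), 1 ≤ n → ∀ (u : (Fin d → ℝ) → ℝ), C2Nbhd d u →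
      (∀ x ∈ frontier (cube d), u x = 0) →
      |(∫ x in cube d, u x) -
          mesh n ^ d * ∑ i : Fin d → Fin n, u (gridPt d n i)| ≤
        C * mesh n ^ 2 * Real.sqrt (H2sq d u) := by
  refine ⟨(2 * d ^ 2 + d) * √2, ?_, fun n _ u hu h0 => ?_⟩
  · have : (0 : ℝ) < d := by rcases hd with rfl | rfl | rfl <;> norm_num
    positivity
  obtain ⟨v, hv, V, hV, hcV, huv⟩ := hu.exists_contDiff
  have hmem : ∀ i : Fin d → Fin n, gridPt d n i ∈ cube d := fun i => by
    have hpos := mesh_pos n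
    refine ⟨fun j => ?_, fun j => ?_⟩
    · simp only [Pi.zero_apply, gridPt]
      positivity
    · have : ((i j : ℕ) : ℝ) + 1 ≤ n := by exact_mod_cast (i j).2
      simp only [Pi.one_apply, gridPt, mesh, mul_one_div]
      rw [div_le_one (by positivity)]
      linarith
  have hint : ∫ x in cube d, u x = ∫ x in cube d, v x :=
    setIntegral_congr_fun measurableSet_Icc (huv.mono hcV)
  rw [hint,
    Finset.sum_congr rfl fun i _ => huv (hcV (hmem i)), H2sq_congr hV hcV huv]
  refine (abs_integral_sub_grid_sum_le (by omega) n hv fun x hx j hj => ?_).trans ?_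
  · rw [← huv (hcV hx)]
    exact h0 x (mem_frontier_cube hx hj)
  · have := Real.sqrt_le_sqrt (hessSq_le_two_mul_H2sq hv)
    rw [Real.sqrt_mul zero_le_two] at this
    calc (2 * d ^ 2 + d) * mesh n ^ 2 * √(hessSq d v)
        ≤ (2 * d ^ 2 + d) * mesh n ^ 2 * (√2 * √(H2sq d v)) := by gcongr
      _ = _ := by ring
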